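/- arXiv:math/0605349 — 3 statements merged into one kernel-verified Lean document; each statement's English description precedes it below -/
import Mathlib

section
/- Fix z₀ ∈ ℂ and s₀ > 0, and let u = u(s,z) be a complex-valued C² function on a neighborhood of the closed cone {(s,z) : 0 ≤ s ≤ s₀, |z − z₀| ≤ s₀ − s} satisfying the wave equation ∂²u/∂s² + □̃_{τp} u = 0 there. If u(0,z) = 0 and (∂u/∂s)(0,z) = 0 for all z ∈ D(z₀,s₀), then u(s,z) = 0 for all (s,z) in the cone {(s,z) : 0 ≤ s ≤ s₀, |z − z₀| < s₀ − s}. -/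
open MeasureTheory Complex

noncomputable section

/-- Partial derivative in the `x₁` (real-axis) direction. -/
def pd₁ (f : ℂ → ℂ) (z : ℂ) : ℂ := fderiv ℝ f z 1

/-- Partial derivative in the `x₂` (imaginary-axis) direction. -/
def pd₂ (f : ℂ → ℂ) (z : ℂ) : ℂ := fderiv ℝ f z Complex.I

/-- Partial derivative in the `x₁` direction of a real-valued function. -/
def pdR₁ (p : ℂ → ℝ) (z : ℂ) : ℝ := fderiv ℝ p z 1

/-- Partial derivative in the `x₂` direction of a real-valued function. -/
def pdR₂ (p : ℂ → ℝ) (z : ℂ) : ℝ := fderiv ℝ p z Complex.I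

/-- `X₁ = ∂/∂x₁ + iτ ∂p/∂x₂`. -/
def X₁ (p : ℂ → ℝ) (τ : ℝ) (f : ℂ → ℂ) (z : ℂ) : ℂ :=
  pd₁ f z + Complex.I * τ * (pdR₂ p z) * f z

/-- `X₂ = ∂/∂x₂ - iτ ∂p/∂x₁`. -/
def X₂ (p : ℂ → ℝ) (τ : ℝ) (f : ℂ → ℂ) (z : ℂ) : ℂ :=
  pd₂ f z - Complex.I * τ * (pdR₁ p z) * f z

/-- Wirtinger derivative `∂/∂z = ½(∂/∂x₁ − i ∂/∂x₂)`. -/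
def Wz (f : ℂ → ℂ) (z : ℂ) : ℂ := (1 / 2 : ℂ) * (pd₁ f z - Complex.I * pd₂ f z)

/-- Wirtinger derivative `∂/∂z̄ = ½(∂/∂x₁ + i ∂/∂x₂)`. -/
def Wzb (f : ℂ → ℂ) (z : ℂ) : ℂ := (1 / 2 : ℂ) * (pd₁ f z + Complex.I * pd₂ f z)

/-- `Z̄_{τp} = ∂/∂z̄ + τ (∂p/∂z̄)`. -/
def Zb (p : ℂ → ℝ) (τ : ℝ) (f : ℂ → ℂ) (z : ℂ) : ℂ :=
  Wzb f z + τ * Wzb (fun w => (p w : ℂ)) z * f z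

/-- `Z_{τp} = ∂/∂z − τ (∂p/∂z)`. -/
def Zop (p : ℂ → ℝ) (τ : ℝ) (f : ℂ → ℂ) (z : ℂ) : ℂ :=
  Wz f z - τ * Wz (fun w => (p w : ℂ)) z * f z

/-- `□_{τp} = −Z̄_{τp} ∘ Z_{τp}`. -/
def Box (p : ℂ → ℝ) (τ : ℝ) (f : ℂ → ℂ) (z : ℂ) : ℂ := -(Zb p τ (Zop p τ f) z)

/-- `□̃_{τp} = −Z_{τp} ∘ Z̄_{τp}`. -/
def BoxT (p : ℂ → ℝ) (τ : ℝ) (f : ℂ → ℂ) (z : ℂ) : ℂ := -(Zop p τ (Zb p τ f) z)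

/-- The Laplacian of a real-valued function on `ℂ ≅ ℝ²`. -/
def lapR (p : ℂ → ℝ) (z : ℂ) : ℝ :=
  fderiv ℝ (fun w => pdR₁ p w) z 1 + fderiv ℝ (fun w => pdR₂ p w) z Complex.I

/-- `p : ℂ → ℝ` is a polynomial in the underlying real coordinates. -/
def IsRealPoly (p : ℂ → ℝ) : Prop :=
  ∃ P : MvPolynomial (Fin 2) ℝ, ∀ z : ℂ, p z = MvPolynomial.eval ![z.re, z.im] P

/-- `A_{jk}(z) = (1/(j!k!)) ∂^{j+k} p / ∂z^j ∂z̄^k (z)`. -/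
def Ajk (p : ℂ → ℝ) (j k : ℕ) (z : ℂ) : ℂ :=
  (1 / (Nat.factorial j * Nat.factorial k) : ℂ) *
    (Wz^[j] (Wzb^[k] (fun w => (p w : ℂ)))) z

/-- `μ_p(z,δ) = inf { |δ/A_{jk}(z)|^{1/(j+k)} : j,k ≥ 1, A_{jk}(z) ≠ 0 }`. -/
def mu (p : ℂ → ℝ) (z : ℂ) (δ : ℝ) : ℝ :=
  sInf { r : ℝ | ∃ j k : ℕ, 1 ≤ j ∧ 1 ≤ k ∧ Ajk p j k z ≠ 0 ∧
    r = ‖(δ : ℂ) / Ajk p j k z‖ ^ (((j + k : ℕ) : ℝ))⁻¹ }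

/-- `Λ(z,δ) = Σ_{j,k ≥ 1} |A_{jk}(z)| δ^{j+k}`. -/
def Lam (p : ℂ → ℝ) (z : ℂ) (δ : ℝ) : ℝ :=
  ∑' j : ℕ, ∑' k : ℕ, ‖Ajk p (j + 1) (k + 1) z‖ * δ ^ (j + k + 2)


/-- Time derivative `∂u/∂s` for `u : ℝ × ℂ → ℂ`. -/
def timeDeriv (u : ℝ × ℂ → ℂ) (q : ℝ × ℂ) : ℂ := fderiv ℝ u q (1, 0)

theorem int_zero_aux {f : ℝ × ℂ → ℝ} {U K : Set (ℝ × ℂ)} (hU : IsOpen U) (hK : IsCompact K)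
    (hKU : K ⊆ U) (hf : ContDiffOn ℝ 1 f U)
    (hb : ∀ q ∈ K, q ∉ interior K → f q = 0 ∧ fderiv ℝ f q = 0) (v : ℝ × ℂ) :
    IntegrableOn (fun q => fderiv ℝ f q v) K ∧ ∫ q in K, fderiv ℝ f q v = 0 := by
  have hc : ContinuousOn (fun q => fderiv ℝ f q v) K :=
    ((hf.continuousOn_fderiv_of_isOpen hU le_rfl).mono hKU).clm_apply continuousOn_const
  have hi : IntegrableOn (fun q => fderiv ℝ f q v) K := hc.integrableOn_compact hK
  have hi0 : IntegrableOn f K := (hf.continuousOn.mono hKU).integrableOn_compact hK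
  have hder : ∀ q, HasFDerivAt (K.indicator f) (K.indicator (fderiv ℝ f) q) q := by
    intro q
    by_cases hq : q ∈ K
    · have hd : HasFDerivAt f (fderiv ℝ f q) q :=
        ((hf.differentiableOn one_ne_zero).differentiableAt (hU.mem_nhds (hKU hq))).hasFDerivAt
      rw [Set.indicator_of_mem hq]
      by_cases hq' : q ∈ interior K
      · refine hd.congr_of_eventuallyEq ?_
        filter_upwards [mem_interior_iff_mem_nhds.1 hq'] with x hx
        exact Set.indicator_of_mem hx f
      · obtain ⟨h0, h1⟩ := hb q hq hq'
        rw [h1] at hd ⊢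
        rw [hasFDerivAt_iff_isLittleO] at hd ⊢
        refine Asymptotics.IsBigO.trans_isLittleO ?_ hd
        refine Asymptotics.IsBigO.of_bound 1 (Filter.Eventually.of_forall fun x => ?_)
        rw [Set.indicator_of_mem hq, h0]
        simp only [sub_zero, zero_apply, one_mul]
        exact norm_indicator_le_norm_self f x
    · rw [Set.indicator_of_notMem hq]
      refine (hasFDerivAt_const (0:ℝ) q).congr_of_eventuallyEq ?_
      filter_upwards [hK.isClosed.isOpen_compl.mem_nhds hq] with x hx
      exact Set.indicator_of_notMem hx f
  refine ⟨hi, ?_⟩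
  have hKm : MeasurableSet K := hK.isClosed.measurableSet
  have e : (fun q => K.indicator (fderiv ℝ f) q v) = K.indicator (fun q => fderiv ℝ f q v) := by
    ext q
    by_cases hq : q ∈ K <;> simp [hq]
  have hH : (volume : Measure (ℝ × ℂ)).IsAddHaarMeasure := by
    rw [Measure.volume_eq_prod]
    infer_instance
  have key := integral_bilinear_hasLineDerivAt_right_eq_neg_left_of_integrable
    (μ := (volume : Measure (ℝ × ℂ))) (f := fun _ => (1:ℝ)) (f' := fun _ => (0:ℝ))
    (g := K.indicator f) (g' := fun q => K.indicator (fderiv ℝ f) q v) (v := v)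
    (B := ContinuousLinearMap.mul ℝ ℝ) (by simp)
    (by
      simp only [ContinuousLinearMap.mul_apply', one_mul]
      rw [e]
      exact hi.integrable_indicator hKm)
    (by
      simp only [ContinuousLinearMap.mul_apply', one_mul]
      exact hi0.integrable_indicator hKm)
    (fun x _ => by simpa using (hasFDerivAt_const (1:ℝ) x).hasLineDerivAt v)
    (fun x _ => (hder x).hasLineDerivAt v)
  simp only [ContinuousLinearMap.mul_apply', one_mul, zero_mul, integral_zero, neg_zero] at key
  rw [e, integral_indicator hKm] at key
  exact key

theorem int_comb_aux {K : Set (ℝ × ℂ)} {f g h k : ℝ × ℂ → ℝ}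
    (hf : IntegrableOn f K ∧ ∫ q in K, f q = 0) (hg : IntegrableOn g K ∧ ∫ q in K, g q = 0)
    (hh : IntegrableOn h K ∧ ∫ q in K, h q = 0) (hk : IntegrableOn k K ∧ ∫ q in K, k q = 0) :
    ∫ q in K, (f q + g q - h q - k q) = 0 := by
  have e1 : IntegrableOn (fun q => f q + g q) K := hf.1.add hg.1
  have e2 : IntegrableOn (fun q => f q + g q - h q) K := e1.sub hh.1
  rw [integral_sub e2 hk.1, integral_sub e1 hh.1, integral_add hf.1 hg.1,
    hf.2, hg.2, hh.2, hk.2]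
  simp

theorem realPoly_contDiff {p : ℂ → ℝ} (h : IsRealPoly p) : ContDiff ℝ 3 p := by
  obtain ⟨P, hP⟩ := h
  have : p = fun z : ℂ => MvPolynomial.eval ![z.re, z.im] P := funext hP
  rw [this]
  clear hP this
  induction P using MvPolynomial.induction_on with
  | C a => simpa using contDiff_const
  | add P Q h1 h2 => simpa using h1.add h2
  | mul_X P i h1 =>
    simp only [map_mul, MvPolynomial.eval_X]
    refine h1.mul ?_
    fin_cases i
    · exact Complex.reCLM.contDiff
    · exact Complex.imCLM.contDiff

/-- The squared defining function of the cone. -/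
def wt (z₀ : ℂ) (s₀ : ℝ) (q : ℝ × ℂ) : ℝ :=
  (s₀ - q.1) ^ 2 - ((q.2.re - z₀.re) ^ 2 + (q.2.im - z₀.im) ^ 2)

theorem wt_contDiff (z₀ : ℂ) (s₀ : ℝ) : ContDiff ℝ 1 (wt z₀ s₀) := by
  have h1 : ContDiff ℝ 1 (fun q : ℝ × ℂ => q.2.re) := Complex.reCLM.contDiff.comp contDiff_snd
  have h2 : ContDiff ℝ 1 (fun q : ℝ × ℂ => q.2.im) := Complex.imCLM.contDiff.comp contDiff_snd
  have h3 : ContDiff ℝ 1 (fun q : ℝ × ℂ => q.1) := contDiff_fst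
  unfold wt
  exact ((contDiff_const.sub h3).pow 2).sub
    (((h1.sub contDiff_const).pow 2).add ((h2.sub contDiff_const).pow 2))

theorem wt_fderiv (z₀ : ℂ) (s₀ : ℝ) (q v : ℝ × ℂ) : fderiv ℝ (wt z₀ s₀) q v =
    -2 * (s₀ - q.1) * v.1 - 2 * (q.2.re - z₀.re) * v.2.re - 2 * (q.2.im - z₀.im) * v.2.im := by
  have h1 : HasFDerivAt (fun q : ℝ × ℂ => q.2.re)
      (Complex.reCLM.comp (ContinuousLinearMap.snd ℝ ℝ ℂ)) q :=
    (Complex.reCLM.comp (ContinuousLinearMap.snd ℝ ℝ ℂ)).hasFDerivAt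
  have h2 : HasFDerivAt (fun q : ℝ × ℂ => q.2.im)
      (Complex.imCLM.comp (ContinuousLinearMap.snd ℝ ℝ ℂ)) q :=
    (Complex.imCLM.comp (ContinuousLinearMap.snd ℝ ℝ ℂ)).hasFDerivAt
  have h3 : HasFDerivAt (fun q : ℝ × ℂ => q.1) (ContinuousLinearMap.fst ℝ ℝ ℂ) q :=
    (ContinuousLinearMap.fst ℝ ℝ ℂ).hasFDerivAt
  have h := ((h3.const_sub s₀).pow 2).sub
    (((h1.sub_const z₀.re).pow 2).add ((h2.sub_const z₀.im).pow 2))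
  have h' : HasFDerivAt (wt z₀ s₀) _ q := h
  rw [h'.fderiv]
  simp
  ring

/-- Derivative of `wt² · (a₁ b₁ + a₂ b₂)`-type expressions. -/
theorem quad_fderiv {g a b c d : ℝ × ℂ → ℝ} {q : ℝ × ℂ} (hg : DifferentiableAt ℝ g q)
    (ha : DifferentiableAt ℝ a q) (hb : DifferentiableAt ℝ b q)
    (hc : DifferentiableAt ℝ c q) (hd : DifferentiableAt ℝ d q) :
    fderiv ℝ (fun q => g q ^ 2 * (a q * b q + c q * d q)) q =
      (2 * g q * (a q * b q + c q * d q)) • fderiv ℝ g q +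
      g q ^ 2 • (a q • fderiv ℝ b q + b q • fderiv ℝ a q +
        (c q • fderiv ℝ d q + d q • fderiv ℝ c q)) := by
  have h := (hg.hasFDerivAt.pow 2).mul
    ((ha.hasFDerivAt.mul hb.hasFDerivAt).add (hc.hasFDerivAt.mul hd.hasFDerivAt))
  have h' : HasFDerivAt (fun q => g q ^ 2 * (a q * b q + c q * d q)) _ q := h
  rw [h'.fderiv]
  ext v
  all_goals simp
  all_goals ring

/-- Integral of derivative of the quadratic expression over the cone vanishes. -/
theorem quad_int {z₀ : ℂ} {s₀ : ℝ} {U K : Set (ℝ × ℂ)} (hU : IsOpen U) (hK : IsCompact K)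
    (hKU : K ⊆ U) {a b c d : ℝ × ℂ → ℝ}
    (ha : ContDiffOn ℝ 1 a U) (hb : ContDiffOn ℝ 1 b U)
    (hc : ContDiffOn ℝ 1 c U) (hd : ContDiffOn ℝ 1 d U)
    (hbd : ∀ q ∈ K, q ∉ interior K →
      wt z₀ s₀ q = 0 ∨ (a q = 0 ∧ b q = 0 ∧ c q = 0 ∧ d q = 0)) (v : ℝ × ℂ) :
    IntegrableOn (fun q => fderiv ℝ (fun q => wt z₀ s₀ q ^ 2 * (a q * b q + c q * d q)) q v) K ∧
    ∫ q in K, fderiv ℝ (fun q => wt z₀ s₀ q ^ 2 * (a q * b q + c q * d q)) q v = 0 := by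
  refine int_zero_aux hU hK hKU ?_ ?_ v
  · exact ((wt_contDiff z₀ s₀).contDiffOn.pow 2).mul ((ha.mul hb).add (hc.mul hd))
  · intro q hq hq'
    have D : ∀ {f : ℝ × ℂ → ℝ}, ContDiffOn ℝ 1 f U → DifferentiableAt ℝ f q := fun h =>
      (h.differentiableOn one_ne_zero).differentiableAt (hU.mem_nhds (hKU hq))
    rw [quad_fderiv (D (wt_contDiff z₀ s₀).contDiffOn) (D ha) (D hb) (D hc) (D hd)]
    rcases hbd q hq hq' with h | ⟨h1, h2, h3, h4⟩
    · simp [h]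
    · simp [h1, h2, h3, h4]

theorem energy_aux (z₀ : ℂ) (s₀ : ℝ) (U : Set (ℝ × ℂ)) (hU : IsOpen U)
    (hcone : {q : ℝ × ℂ | 0 ≤ q.1 ∧ q.1 ≤ s₀ ∧ dist q.2 z₀ ≤ s₀ - q.1} ⊆ U)
    (a b α : ℝ × ℂ → ℂ) (ha : ContDiffOn ℝ 1 a U) (hb : ContDiffOn ℝ 1 b U)
    (h1 : ∀ q ∈ U, fderiv ℝ a q (1, 0) = (1 / 2 : ℂ) *
      (fderiv ℝ b q (0, 1) - Complex.I * fderiv ℝ b q (0, Complex.I))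
        - (starRingEnd ℂ) (α q) * b q)
    (h2 : ∀ q ∈ U, fderiv ℝ b q (1, 0) = (1 / 2 : ℂ) *
      (fderiv ℝ a q (0, 1) + Complex.I * fderiv ℝ a q (0, Complex.I)) + α q * a q)
    (ha0 : ∀ w ∈ Metric.ball z₀ s₀, a (0, w) = 0)
    (hb0 : ∀ w ∈ Metric.ball z₀ s₀, b (0, w) = 0) :
    ∀ q : ℝ × ℂ, 0 < q.1 → dist q.2 z₀ < s₀ - q.1 → a q = 0 := by
  set K : Set (ℝ × ℂ) := {q : ℝ × ℂ | 0 ≤ q.1 ∧ q.1 ≤ s₀ ∧ dist q.2 z₀ ≤ s₀ - q.1} with hKdef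
  have hKc : IsClosed K := by
    refine (isClosed_le continuous_const continuous_fst).inter
      ((isClosed_le continuous_fst continuous_const).inter
        (isClosed_le (continuous_snd.dist continuous_const)
          (continuous_const.sub continuous_fst)))
  have hK : IsCompact K := by
    refine (isCompact_Icc.prod (isCompact_closedBall z₀ s₀)).of_isClosed_subset hKc
      (s := Set.Icc 0 s₀ ×ˢ Metric.closedBall z₀ s₀) ?_
    rintro q ⟨h, h', h''⟩
    exact ⟨⟨h, h'⟩, by rw [Metric.mem_closedBall]; linarith⟩
  set V : Set (ℝ × ℂ) := {q : ℝ × ℂ | 0 < q.1 ∧ dist q.2 z₀ < s₀ - q.1} with hVdef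
  have hVo : IsOpen V := (isOpen_lt continuous_const continuous_fst).inter
        (isOpen_lt (continuous_snd.dist continuous_const)
          (continuous_const.sub continuous_fst))
  have hVK : V ⊆ K := by
    rintro q ⟨h, h'⟩
    have := dist_nonneg (x := q.2) (y := z₀)
    exact ⟨h.le, by linarith, h'.le⟩
  have hVi : V ⊆ interior K := interior_maximal hVK hVo
  have hdist : ∀ q : ℝ × ℂ, dist q.2 z₀ ^ 2 = (q.2.re - z₀.re) ^ 2 + (q.2.im - z₀.im) ^ 2 := by
    intro q
    rw [Complex.dist_eq, ← Complex.normSq_eq_norm_sq, Complex.normSq_apply]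
    simp
    ring
  have hwt : ∀ q : ℝ × ℂ, wt z₀ s₀ q = (s₀ - q.1) ^ 2 - dist q.2 z₀ ^ 2 := by
    intro q
    rw [hdist]
    rfl
  -- boundary values
  have hbd : ∀ q ∈ K, q ∉ interior K → wt z₀ s₀ q = 0 ∨ (a q = 0 ∧ b q = 0) := by
    rintro ⟨s, w⟩ hq hq'
    have hq2 : (s, w) ∉ V := fun h => hq' (hVi h)
    obtain ⟨k1, k2, k3⟩ := hq
    simp only at k1 k2 k3
    rcases k3.eq_or_lt with h | h
    · left
      rw [hwt]
      simp only
      rw [h]; ring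
    · right
      have hs : s = 0 := by
        by_contra hne
        exact hq2 ⟨lt_of_le_of_ne k1 (Ne.symm hne), h⟩
      subst hs
      have hw : w ∈ Metric.ball z₀ s₀ := by
        rw [Metric.mem_ball]; linarith
      exact ⟨ha0 w hw, hb0 w hw⟩
  -- real and imaginary parts
  have har : ContDiffOn ℝ 1 (fun q => (a q).re) U := Complex.reCLM.contDiff.comp_contDiffOn ha
  have hai : ContDiffOn ℝ 1 (fun q => (a q).im) U := Complex.imCLM.contDiff.comp_contDiffOn ha
  have hbr : ContDiffOn ℝ 1 (fun q => (b q).re) U := Complex.reCLM.contDiff.comp_contDiffOn hb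
  have hbi : ContDiffOn ℝ 1 (fun q => (b q).im) U := Complex.imCLM.contDiff.comp_contDiffOn hb
  have hbin : ContDiffOn ℝ 1 (fun q => -(b q).re) U := hbr.neg
  have I1 := quad_int (z₀ := z₀) (s₀ := s₀) hU hK hcone har har hai hai
    (fun q hq hq' => (hbd q hq hq').imp id (fun h => by simp [h.1])) (1, 0)
  have I2 := quad_int (z₀ := z₀) (s₀ := s₀) hU hK hcone hbr hbr hbi hbi
    (fun q hq hq' => (hbd q hq hq').imp id (fun h => by simp [h.2])) (1, 0)
  have I3 := quad_int (z₀ := z₀) (s₀ := s₀) hU hK hcone har hbr hai hbi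
    (fun q hq hq' => (hbd q hq hq').imp id (fun h => by simp [h.1, h.2])) (0, 1)
  have I4 := quad_int (z₀ := z₀) (s₀ := s₀) hU hK hcone har hbi hai hbin
    (fun q hq hq' => (hbd q hq hq').imp id (fun h => by simp [h.1, h.2])) (0, Complex.I)
  -- the divergence
  set G : ℝ × ℂ → ℝ := fun q => 4 * wt z₀ s₀ q * ((s₀ - q.1) *
      ((a q).re ^ 2 + (a q).im ^ 2 + (b q).re ^ 2 + (b q).im ^ 2)
      - (q.2.re - z₀.re) * ((a q).re * (b q).re + (a q).im * (b q).im)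
      - (q.2.im - z₀.im) * ((a q).re * (b q).im - (a q).im * (b q).re)) with hG
  have hI : ∫ q in K, G q = 0 := by
    have e : ∀ q ∈ K, G q =
      ((fderiv ℝ (fun q => wt z₀ s₀ q ^ 2 * ((a q).re * (b q).re + (a q).im * (b q).im)) q (0, 1)
      + fderiv ℝ (fun q => wt z₀ s₀ q ^ 2 * ((a q).re * (b q).im + (a q).im * -(b q).re)) q
        (0, Complex.I))
      - fderiv ℝ (fun q => wt z₀ s₀ q ^ 2 * ((a q).re * (a q).re + (a q).im * (a q).im)) q (1, 0))
      - fderiv ℝ (fun q => wt z₀ s₀ q ^ 2 * ((b q).re * (b q).re + (b q).im * (b q).im)) q (1, 0)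
      := by
      intro q hq
      have hqU := hcone hq
      have D : ∀ {f : ℝ × ℂ → ℝ}, ContDiffOn ℝ 1 f U → DifferentiableAt ℝ f q := fun h =>
        (h.differentiableOn one_ne_zero).differentiableAt (hU.mem_nhds hqU)
      have Dw := D (wt_contDiff z₀ s₀).contDiffOn
      rw [quad_fderiv Dw (D har) (D hbr) (D hai) (D hbi),
        quad_fderiv Dw (D har) (D hbi) (D hai) (D hbin),
        quad_fderiv Dw (D har) (D har) (D hai) (D hai),
        quad_fderiv Dw (D hbr) (D hbr) (D hbi) (D hbi)]
      have da : HasFDerivAt a (fderiv ℝ a q) q :=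
        ((ha.differentiableOn one_ne_zero).differentiableAt (hU.mem_nhds hqU)).hasFDerivAt
      have db : HasFDerivAt b (fderiv ℝ b q) q :=
        ((hb.differentiableOn one_ne_zero).differentiableAt (hU.mem_nhds hqU)).hasFDerivAt
      have d1 : HasFDerivAt (fun q => (a q).re) (Complex.reCLM.comp (fderiv ℝ a q)) q :=
        Complex.reCLM.hasFDerivAt.comp q da
      have d2 : HasFDerivAt (fun q => (a q).im) (Complex.imCLM.comp (fderiv ℝ a q)) q :=
        Complex.imCLM.hasFDerivAt.comp q da
      have d3 : HasFDerivAt (fun q => (b q).re) (Complex.reCLM.comp (fderiv ℝ b q)) q :=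
        Complex.reCLM.hasFDerivAt.comp q db
      have d4 : HasFDerivAt (fun q => (b q).im) (Complex.imCLM.comp (fderiv ℝ b q)) q :=
        Complex.imCLM.hasFDerivAt.comp q db
      have d5 : HasFDerivAt (fun q => -(b q).re) (-(Complex.reCLM.comp (fderiv ℝ b q))) q :=
        d3.neg
      rw [d1.fderiv, d2.fderiv, d3.fderiv, d4.fderiv, d5.fderiv]
      have k1 := h1 q hqU
      have k2 := h2 q hqU
      have k1r := congrArg Complex.re k1
      have k1i := congrArg Complex.im k1
      have k2r := congrArg Complex.re k2
      have k2i := congrArg Complex.im k2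
      have half : (1 / 2 : ℂ) = ((1 / 2 : ℝ) : ℂ) := by push_cast; rfl
      rw [half] at k1r k1i k2r k2i
      simp only [Complex.add_re, Complex.add_im, Complex.sub_re, Complex.sub_im, Complex.mul_re,
        Complex.mul_im, Complex.ofReal_re, Complex.ofReal_im, Complex.I_re, Complex.I_im,
        Complex.conj_re, Complex.conj_im] at k1r k1i k2r k2i
      simp only [hG, add_apply, smul_apply,
        neg_apply, ContinuousLinearMap.comp_apply, Complex.reCLM_apply,
        Complex.imCLM_apply, smul_eq_mul, wt_fderiv, Complex.zero_re, Complex.zero_im,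
        Complex.one_re, Complex.one_im, Complex.I_re, Complex.I_im, k1r, k1i, k2r, k2i]
      ring
    rw [setIntegral_congr_fun hKc.measurableSet e]
    exact int_comb_aux I3 I4 I1 I2
  have hGc : ContinuousOn G K := by
    have c1 := har.continuousOn.mono hcone
    have c2 := hai.continuousOn.mono hcone
    have c3 := hbr.continuousOn.mono hcone
    have c4 := hbi.continuousOn.mono hcone
    have c5 : ContinuousOn (wt z₀ s₀) K := (wt_contDiff z₀ s₀).continuous.continuousOn
    have c6 : ContinuousOn (fun q : ℝ × ℂ => q.2.re) K :=
      (Complex.continuous_re.comp continuous_snd).continuousOn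
    have c7 : ContinuousOn (fun q : ℝ × ℂ => q.2.im) K :=
      (Complex.continuous_im.comp continuous_snd).continuousOn
    fun_prop
  have hlow : ∀ q ∈ K, 2 * wt z₀ s₀ q * (s₀ - q.1) *
      ((a q).re ^ 2 + (a q).im ^ 2 + (b q).re ^ 2 + (b q).im ^ 2) ≤ G q := by
    intro q hq
    obtain ⟨k1, k2, k3⟩ := hq
    have hd0 := dist_nonneg (x := q.2) (y := z₀)
    have hw0 : 0 ≤ wt z₀ s₀ q := by rw [hwt]; nlinarith
    have hh : 0 ≤ s₀ - q.1 := by linarith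
    have hr : (q.2.re - z₀.re) ^ 2 + (q.2.im - z₀.im) ^ 2 ≤ (s₀ - q.1) ^ 2 := by
      rw [← hdist]; nlinarith
    have key : ∀ x y h A B C D : ℝ, 0 ≤ h → x ^ 2 + y ^ 2 ≤ h ^ 2 →
        x * (A * C + B * D) + y * (A * D - B * C) ≤
          h * (A ^ 2 + B ^ 2 + C ^ 2 + D ^ 2) / 2 := by
      intro x y h A B C D hh hr
      refine le_of_abs_le (abs_le_of_sq_le_sq ?_ ?_)
      swap
      · positivity
      · have e1 : (x * (A * C + B * D) + y * (A * D - B * C)) ^ 2 ≤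
            (x ^ 2 + y ^ 2) * ((A ^ 2 + B ^ 2) * (C ^ 2 + D ^ 2)) := by
          nlinarith [sq_nonneg (x * (A * D - B * C) - y * (A * C + B * D))]
        have e2 : (x ^ 2 + y ^ 2) * ((A ^ 2 + B ^ 2) * (C ^ 2 + D ^ 2)) ≤
            h ^ 2 * ((A ^ 2 + B ^ 2) * (C ^ 2 + D ^ 2)) := by gcongr
        have e3 : h ^ 2 * ((A ^ 2 + B ^ 2) * (C ^ 2 + D ^ 2)) ≤
            h ^ 2 * ((A ^ 2 + B ^ 2 + C ^ 2 + D ^ 2) ^ 2 / 4) := by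
          gcongr
          nlinarith [sq_nonneg (A ^ 2 + B ^ 2 - (C ^ 2 + D ^ 2))]
        calc _ ≤ _ := e1.trans (e2.trans e3)
          _ = _ := by ring
    have k := key _ _ _ (a q).re (a q).im (b q).re (b q).im hh hr
    have k' := mul_le_mul_of_nonneg_left k hw0
    simp only [hG]
    nlinarith
  have hnn : ∀ q ∈ K, 0 ≤ G q := by
    intro q hq
    refine le_trans ?_ (hlow q hq)
    obtain ⟨k1, k2, k3⟩ := hq
    have hd0 := dist_nonneg (x := q.2) (y := z₀)
    have hw0 : 0 ≤ wt z₀ s₀ q := by rw [hwt]; nlinarith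
    have hh : 0 ≤ s₀ - q.1 := by linarith
    positivity
  have hae := (setIntegral_eq_zero_iff_of_nonneg_ae
    ((ae_restrict_iff' hKc.measurableSet).2 (Filter.Eventually.of_forall hnn))
    (hGc.integrableOn_compact hK)).1 hI
  have heq : Set.EqOn G 0 V := Measure.eqOn_open_of_ae_eq
    (ae_restrict_of_ae_restrict_of_subset hVK hae) hVo (hGc.mono hVK) continuousOn_const
  intro q hq1 hq2
  have hqV : q ∈ V := ⟨hq1, hq2⟩
  have hz := hlow q (hVK hqV)
  rw [heq hqV] at hz
  have hd0 := dist_nonneg (x := q.2) (y := z₀)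
  have hw0 : 0 < wt z₀ s₀ q := by rw [hwt]; nlinarith
  have hh : 0 < s₀ - q.1 := by linarith
  have hpos : 0 < 2 * wt z₀ s₀ q * (s₀ - q.1) := by positivity
  have hz' : (a q).re ^ 2 + (a q).im ^ 2 + (b q).re ^ 2 + (b q).im ^ 2 ≤ 0 := by
    by_contra hcon
    push Not at hcon
    have := mul_pos hpos hcon
    simp only [Pi.zero_apply] at hz
    linarith
  have n1 := sq_nonneg (a q).re
  have n2 := sq_nonneg (a q).im
  have n3 := sq_nonneg (b q).re
  have n4 := sq_nonneg (b q).im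
  apply Complex.ext
  · exact pow_eq_zero_iff two_ne_zero |>.1 (by linarith : (a q).re ^ 2 = 0)
  · exact pow_eq_zero_iff two_ne_zero |>.1 (by linarith : (a q).im ^ 2 = 0)

/-- Corollary `cor:fps`: finite propagation speed. -/
theorem statement13 (p : ℂ → ℝ) (hpoly : IsRealPoly p) (τ : ℝ)
    (z₀ : ℂ) (s₀ : ℝ) (hs₀ : 0 < s₀)
    (u : ℝ × ℂ → ℂ) (U : Set (ℝ × ℂ)) (hU : IsOpen U)
    (hcone : {q : ℝ × ℂ | 0 ≤ q.1 ∧ q.1 ≤ s₀ ∧ dist q.2 z₀ ≤ s₀ - q.1} ⊆ U)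
    (hu : ContDiffOn ℝ 2 u U)
    (hwave : ∀ q ∈ U,
      timeDeriv (timeDeriv u) q + BoxT p τ (fun w => u (q.1, w)) q.2 = 0)
    (hinit : ∀ w ∈ Metric.ball z₀ s₀, u (0, w) = 0)
    (hinit' : ∀ w ∈ Metric.ball z₀ s₀, timeDeriv u (0, w) = 0) :
    ∀ s : ℝ, 0 ≤ s → s ≤ s₀ → ∀ w : ℂ, dist w z₀ < s₀ - s → u (s, w) = 0 := by
  have hpC : ContDiff ℝ 3 (fun w => (p w : ℂ)) :=
    Complex.ofRealCLM.contDiff.comp (realPoly_contDiff hpoly)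
  -- the zeroth order coefficient
  set A : ℂ → ℂ := fun z => τ * Wzb (fun w => (p w : ℂ)) z with hA
  have hAc : ContDiff ℝ 1 A := by
    have hd : ContDiff ℝ 1 (fderiv ℝ (fun w => (p w : ℂ))) :=
      (hpC.of_le (by norm_num : (2 : WithTop ℕ∞) ≤ 3)).fderiv_right (by norm_num)
    have e1 : ContDiff ℝ 1 (fun z => fderiv ℝ (fun w => (p w : ℂ)) z 1) :=
      hd.clm_apply contDiff_const
    have e2 : ContDiff ℝ 1 (fun z => fderiv ℝ (fun w => (p w : ℂ)) z Complex.I) :=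
      hd.clm_apply contDiff_const
    exact contDiff_const.mul (contDiff_const.mul (e1.add (contDiff_const.mul e2)))
  have hconj : ∀ z, τ * Wz (fun w => (p w : ℂ)) z = (starRingEnd ℂ) (A z) := by
    intro z
    have hp1 : DifferentiableAt ℝ p z :=
      (realPoly_contDiff hpoly).differentiable (by norm_num) z
    have hfd : fderiv ℝ (fun w => (p w : ℂ)) z = Complex.ofRealCLM.comp (fderiv ℝ p z) :=
      (Complex.ofRealCLM.hasFDerivAt.comp z hp1.hasFDerivAt).fderiv
    simp only [hA, Wz, Wzb, pd₁, pd₂, hfd, ContinuousLinearMap.comp_apply,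
      Complex.ofRealCLM_apply, map_mul, map_add, Complex.conj_ofReal, Complex.conj_I, map_div₀,
      map_one, Complex.conj_ofNat]
    ring
  have hslice : ∀ (f : ℝ × ℂ → ℂ) (q : ℝ × ℂ) (v : ℂ), DifferentiableAt ℝ f q →
      fderiv ℝ (fun w => f (q.1, w)) q.2 v = fderiv ℝ f q (0, v) := by
    intro f q v hf
    have h1 : HasFDerivAt (fun w : ℂ => (q.1, w)) (ContinuousLinearMap.inr ℝ ℝ ℂ) q.2 :=
      hasFDerivAt_prodMk_right q.1 q.2
    have h2 : HasFDerivAt (fun w => f (q.1, w))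
        ((fderiv ℝ f q).comp (ContinuousLinearMap.inr ℝ ℝ ℂ)) q.2 :=
      HasFDerivAt.comp (f := fun w : ℂ => (q.1, w)) q.2 hf.hasFDerivAt h1
    rw [h2.fderiv]
    simp
  have hud : ∀ q ∈ U, DifferentiableAt ℝ u q := fun q hq =>
    (hu.differentiableOn two_ne_zero).differentiableAt (hU.mem_nhds hq)
  have hu' : ContDiffOn ℝ 1 (fderiv ℝ u) U := hu.fderiv_of_isOpen hU (by norm_num)
  have hu'd : ∀ q ∈ U, DifferentiableAt ℝ (fderiv ℝ u) q := fun q hq =>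
    (hu'.differentiableOn one_ne_zero).differentiableAt (hU.mem_nhds hq)
  have hdir : ∀ v, ContDiffOn ℝ 1 (fun q => fderiv ℝ u q v) U := fun v =>
    hu'.clm_apply contDiffOn_const
  have hdird : ∀ q ∈ U, ∀ v, HasFDerivAt (fun q => fderiv ℝ u q v)
      ((fderiv ℝ (fderiv ℝ u) q).flip v) q := by
    intro q hq v
    have := (hu'd q hq).hasFDerivAt.clm_apply (hasFDerivAt_const v q)
    simpa using this
  have hsymm : ∀ q ∈ U, ∀ v w, fderiv ℝ (fderiv ℝ u) q v w = fderiv ℝ (fderiv ℝ u) q w v := by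
    intro q hq v w
    exact (hu.contDiffAt (hU.mem_nhds hq)).isSymmSndFDerivAt (by simp) v w
  set a : ℝ × ℂ → ℂ := timeDeriv u with ha
  set b : ℝ × ℂ → ℂ := fun q => Zb p τ (fun w => u (q.1, w)) q.2 with hb
  set b' : ℝ × ℂ → ℂ := fun q => (1 / 2 : ℂ) * (fderiv ℝ u q (0, 1) +
    Complex.I * fderiv ℝ u q (0, Complex.I)) + A q.2 * u q with hb'
  have hbb : Set.EqOn b b' U := by
    intro q hq
    simp only [hb, hb', Zb, Wzb, pd₁, pd₂, hA]
    rw [hslice u q _ (hud q hq), hslice u q _ (hud q hq)]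
  have haC : ContDiffOn ℝ 1 a U := hdir (1, 0)
  have hb'C : ContDiffOn ℝ 1 b' U :=
    (contDiffOn_const.mul ((hdir _).add (contDiffOn_const.mul (hdir _)))).add
      ((hAc.comp contDiff_snd).contDiffOn.mul (hu.of_le (by norm_num)))
  have hbC : ContDiffOn ℝ 1 b U := hb'C.congr hbb
  have hbd : ∀ q ∈ U, DifferentiableAt ℝ b q := fun q hq =>
    (hbC.differentiableOn one_ne_zero).differentiableAt (hU.mem_nhds hq)
  have key := energy_aux z₀ s₀ U hU hcone a b (fun q => A q.2) haC hbC ?_ ?_ hinit' ?_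
  · -- conclusion
    intro s hs hs' w hw
    have hin : ∀ t ∈ Set.Icc 0 s, (t, w) ∈ U := by
      intro t ht
      exact hcone ⟨ht.1, ht.2.trans hs', by simp only; linarith [ht.2]⟩
    have hder : ∀ t ∈ Set.Icc 0 s, HasDerivAt (fun t => u (t, w)) (a (t, w)) t := by
      intro t ht
      have h1 : HasDerivAt (fun t : ℝ => (t, w)) (1, 0) t :=
        (hasDerivAt_id t).prodMk (hasDerivAt_const t w)
      exact HasFDerivAt.comp_hasDerivAt (f := fun t : ℝ => (t, w)) t
        (hud _ (hin t ht)).hasFDerivAt h1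
    have hconst := constant_of_has_deriv_right_zero (f := fun t => u (t, w)) (a := 0) (b := s)
      (fun t ht => (hder t ht).continuousAt.continuousWithinAt) (fun t ht => by
        have h := hder t ⟨ht.1, ht.2.le⟩
        have h0 : a (t, w) = 0 := by
          rcases ht.1.eq_or_lt with h' | h'
          · rw [← h']
            exact hinit' w (by rw [Metric.mem_ball]; linarith)
          · exact key (t, w) h' (by simp only; linarith [ht.2])
        rw [h0] at h
        exact h.hasDerivWithinAt)
    have := hconst s ⟨hs, le_rfl⟩
    refine this.trans ?_
    exact hinit w (by rw [Metric.mem_ball]; linarith)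
  · -- wave equation
    intro q hq
    have h := hwave q hq
    have e : BoxT p τ (fun w => u (q.1, w)) q.2 = -(Zop p τ (fun w => b (q.1, w)) q.2) := rfl
    rw [e, add_neg_eq_zero] at h
    have h' : fderiv ℝ a q (1, 0) = Zop p τ (fun w => b (q.1, w)) q.2 := h
    rw [h']
    simp only [Zop, hconj]
    simp only [Wz, pd₁, pd₂]
    rw [hslice b q _ (hbd q hq), hslice b q _ (hbd q hq)]
  · -- commutation
    intro q hq
    have e : fderiv ℝ b q = fderiv ℝ b' q :=
      Filter.EventuallyEq.fderiv_eq (hbb.eventuallyEq_of_mem (hU.mem_nhds hq))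
    have hA' : HasFDerivAt (fun q : ℝ × ℂ => A q.2)
        ((fderiv ℝ A q.2).comp (ContinuousLinearMap.snd ℝ ℝ ℂ)) q :=
      HasFDerivAt.comp (g := A) (f := Prod.snd) q ((hAc.differentiable one_ne_zero) q.2).hasFDerivAt hasFDerivAt_snd
    have hd : HasFDerivAt b' _ q :=
      (((hdird q hq (0, 1)).add ((hdird q hq (0, Complex.I)).const_mul Complex.I)).const_mul
        (1 / 2 : ℂ)).add (hA'.mul (hud q hq).hasFDerivAt)
    rw [e, hd.fderiv]
    have hda : fderiv ℝ a q = (fderiv ℝ (fderiv ℝ u) q).flip (1, 0) := (hdird q hq (1, 0)).fderiv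
    rw [hda]
    simp only [add_apply, smul_apply, ContinuousLinearMap.flip_apply,
      ContinuousLinearMap.comp_apply, smul_eq_mul, ContinuousLinearMap.coe_snd']
    rw [hsymm q hq (1, 0) (0, 1), hsymm q hq (1, 0) (0, Complex.I)]
    simp [ha, timeDeriv]
  · -- initial value of b
    intro w hw
    have e : (fun w => u (0, w)) =ᶠ[nhds w] fun _ => 0 := by
      filter_upwards [Metric.isOpen_ball.mem_nhds hw] with x hx
      exact hinit x hx
    have e' : fderiv ℝ (fun w => u (0, w)) w = 0 := by
      rw [e.fderiv_eq]
      simp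
    simp only [hb, Zb, Wzb, pd₁, pd₂, e', hinit w hw]
    simp

end
end

section
/- Fix a sequence of positive constants (a_n). For each N ∈ ℕ there exists a constant C_N > 0, depending only on N and a₀,…,a_N, with the following property: for every ℓ ≥ 1 and every function φ_ℓ ∈ C^∞(ℝ) that is even, satisfies 0 ≤ φ_ℓ ≤ 1, φ_ℓ(x) = 1 for |x| ≥ ℓ, φ_ℓ(x) = 0 for |x| ≤ ℓ/2, and |φ_ℓ^{(n)}(x)| ≤ a_n ℓ^{−n} for all x and all n ≤ N, and for every λ ≥ 0: | (1/2π) ∫_ℝ φ_ℓ(ξ) e^{−ξ²/4} e^{iλξ} dξ | ≤ C_N e^{−ℓ²/16} (ℓ² + λ²)^{−N/2}. -/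
open MeasureTheory Real Complex

noncomputable section

lemma gauss_poly (n : ℕ) : ∃ p : Polynomial ℝ, p.natDegree ≤ n ∧
    iteratedDeriv n (fun x : ℝ => Real.exp (-x ^ 2 / 4)) =
      fun x => p.eval x * Real.exp (-x ^ 2 / 4) := by
  induction n with
  | zero => exact ⟨1, by simp, by simp⟩
  | succ n ih =>
    obtain ⟨p, hp, h⟩ := ih
    refine ⟨Polynomial.derivative p - Polynomial.C (1 / 2) * (p * Polynomial.X), ?_, ?_⟩
    · refine (Polynomial.natDegree_sub_le _ _).trans (max_le ?_ ?_)
      · exact (Polynomial.natDegree_derivative_le p).trans (by omega)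
      · refine (Polynomial.natDegree_C_mul_le _ _).trans ?_
        refine (Polynomial.natDegree_mul_le).trans ?_
        have := Polynomial.natDegree_X_le (R := ℝ)
        omega
    · rw [iteratedDeriv_succ, h]
      funext x
      have h1 : HasDerivAt (fun x : ℝ => -x ^ 2 / 4) (-(2 * x) / 4) x := by
        have := ((hasDerivAt_pow 2 x).neg).div_const 4
        simpa using this
      have h2 := (p.hasDerivAt x).mul h1.exp
      have h3 := h2.deriv
      refine Eq.trans h3 ?_
      simp
      ring

lemma gauss_bound (n : ℕ) : ∃ c : ℝ, 0 ≤ c ∧ ∀ x : ℝ,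
    |iteratedDeriv n (fun x : ℝ => Real.exp (-x ^ 2 / 4)) x| ≤
      c * ((1 + |x|) ^ n * Real.exp (-x ^ 2 / 4)) := by
  obtain ⟨p, hp, h⟩ := gauss_poly n
  refine ⟨∑ i ∈ Finset.range (n + 1), |p.coeff i|, by positivity, fun x => ?_⟩
  rw [h]
  simp only
  rw [abs_mul, abs_of_pos (Real.exp_pos _), ← mul_assoc]
  refine mul_le_mul_of_nonneg_right ?_ (Real.exp_pos _).le
  rw [Polynomial.eval_eq_sum_range' (Nat.lt_succ_of_le hp), Finset.sum_mul]
  refine (Finset.abs_sum_le_sum_abs _ _).trans (Finset.sum_le_sum fun i hi => ?_)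
  rw [abs_mul, abs_pow]
  refine mul_le_mul_of_nonneg_left ?_ (abs_nonneg _)
  have h0 := abs_nonneg x
  calc |x| ^ i ≤ (1 + |x|) ^ i := by gcongr; linarith
    _ ≤ (1 + |x|) ^ n := pow_le_pow_right₀ (by linarith) (by simp at hi; omega)

lemma pt_bound (m j : ℕ) (hj : j ≤ m) (ℓ t : ℝ) (hl : 1 ≤ ℓ) (ht : 0 ≤ t) :
    t ^ m * ((1 + (ℓ / 2 + t)) ^ j * Real.exp (-(ℓ / 2 + t) ^ 2 / 4)) ≤
      (16 ^ m * m.factorial) * (Real.exp (-ℓ ^ 2 / 16) * Real.exp (-(1 / 8) * t ^ 2)) := by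
  set u := ℓ * t + t ^ 2 with hu
  have hu0 : 0 ≤ u := by positivity
  have h1 : (1 + (ℓ / 2 + t)) ^ j ≤ (2 * (ℓ + t)) ^ m :=
    calc (1 + (ℓ / 2 + t)) ^ j ≤ (2 * (ℓ + t)) ^ j := by gcongr; linarith
      _ ≤ _ := pow_le_pow_right₀ (by linarith) hj
  have h2 : (u / 8) ^ m ≤ m.factorial * Real.exp (u / 8) := by
    have := Real.pow_div_factorial_le_exp (u / 8) (by positivity) m
    rw [div_le_iff₀ (by positivity)] at this
    linarith
  have h3 : Real.exp (-(ℓ / 2 + t) ^ 2 / 4) = Real.exp (-ℓ ^ 2 / 16) * Real.exp (-(u / 4)) := by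
    rw [← Real.exp_add]; congr 1; rw [hu]; ring
  have h4 : Real.exp (u / 8) * Real.exp (-(u / 4)) ≤ Real.exp (-(1 / 8) * t ^ 2) := by
    rw [← Real.exp_add]; apply Real.exp_le_exp.2
    have : 0 ≤ ℓ * t := by positivity
    rw [hu]; linarith
  rw [h3]
  calc t ^ m * ((1 + (ℓ / 2 + t)) ^ j * (Real.exp (-ℓ ^ 2 / 16) * Real.exp (-(u / 4))))
      ≤ t ^ m * ((2 * (ℓ + t)) ^ m * (Real.exp (-ℓ ^ 2 / 16) * Real.exp (-(u / 4)))) := by gcongr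
    _ = 16 ^ m * (u / 8) ^ m * (Real.exp (-ℓ ^ 2 / 16) * Real.exp (-(u / 4))) := by
        rw [← mul_assoc, ← mul_pow, ← mul_pow]; congr 2; rw [hu]; ring
    _ ≤ 16 ^ m * (m.factorial * Real.exp (u / 8)) *
          (Real.exp (-ℓ ^ 2 / 16) * Real.exp (-(u / 4))) := by gcongr
    _ = (16 ^ m * m.factorial) * (Real.exp (-ℓ ^ 2 / 16) *
          (Real.exp (u / 8) * Real.exp (-(u / 4)))) := by ring
    _ ≤ _ := by gcongr

lemma cutoff_deriv_zero (ℓ : ℝ) (φ : ℝ → ℝ) (hφ : ContDiff ℝ (⊤ : ℕ∞) φ) (hl : 0 < ℓ)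
    (h0 : ∀ x : ℝ, |x| ≤ ℓ / 2 → φ x = 0) (k : ℕ) (x : ℝ) (hx : |x| ≤ ℓ / 2) :
    iteratedDeriv k φ x = 0 := by
  have hc : Continuous (iteratedDeriv k φ) := hφ.continuous_iteratedDeriv k (by exact_mod_cast le_top)
  have hopen : Set.EqOn (iteratedDeriv k φ) 0 (Set.Ioo (-(ℓ / 2)) (ℓ / 2)) := by
    intro y hy
    have : φ =ᶠ[nhds y] (fun _ => (0 : ℝ)) := by
      filter_upwards [isOpen_Ioo.mem_nhds hy] with z hz
      exact h0 z (abs_le.2 ⟨hz.1.le, hz.2.le⟩)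
    rw [this.iteratedDeriv_eq k]
    simp
  have := hopen.closure hc continuous_const
  rw [closure_Ioo (by linarith)] at this
  exact this (abs_le.1 hx)

lemma flat_bound (N : ℕ) (ℓ M : ℝ) (hM : 0 ≤ M) (φ : ℝ → ℝ) (hφ : ContDiff ℝ (⊤ : ℕ∞) φ)
    (hl : 0 < ℓ) (h0 : ∀ x : ℝ, |x| ≤ ℓ / 2 → φ x = 0)
    (hN : ∀ x, |iteratedDeriv N φ x| ≤ M) (j : ℕ) :
    ∀ k, k + j = N → ∀ t : ℝ, 0 ≤ t → |iteratedDeriv k φ (ℓ / 2 + t)| ≤ M * t ^ j := by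
  induction j with
  | zero =>
    intro k hk t _
    have : k = N := by omega
    subst this
    simpa using hN _
  | succ j ih =>
    intro k hk t ht
    have hd : Differentiable ℝ (iteratedDeriv k φ) :=
      hφ.differentiable_iteratedDeriv k (by exact_mod_cast ENat.natCast_lt_top k)
    have := (convex_Icc (ℓ / 2) (ℓ / 2 + t)).norm_image_sub_le_of_norm_deriv_le
      (f := iteratedDeriv k φ) (C := M * t ^ j) (x := ℓ / 2) (y := ℓ / 2 + t)
      (fun x _ => hd x) (fun x hx => by
        rw [← iteratedDeriv_succ, Real.norm_eq_abs]
        have h1 := ih (k + 1) (by omega) (x - ℓ / 2) (by linarith [hx.1])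
        rw [show ℓ / 2 + (x - ℓ / 2) = x by ring] at h1
        refine h1.trans ?_
        gcongr
        · linarith [hx.1]
        · linarith [hx.2]) ⟨le_rfl, by linarith⟩ ⟨by linarith, le_rfl⟩
    rw [cutoff_deriv_zero ℓ φ hφ hl h0 k (ℓ / 2) (by rw [abs_of_pos]; linarith)] at this
    rw [sub_zero, Real.norm_eq_abs, Real.norm_eq_abs, add_sub_cancel_left, abs_of_nonneg ht] at this
    rw [pow_succ]; linarith

lemma cutoff_even_abs (φ : ℝ → ℝ) (he : ∀ x : ℝ, φ (-x) = φ x) (k : ℕ) (x : ℝ) :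
    |iteratedDeriv k φ x| = |iteratedDeriv k φ (|x|)| := by
  rcases le_total 0 x with h | h
  · rw [abs_of_nonneg h]
  · rw [abs_of_nonpos h]
    have := iteratedDeriv_comp_neg k φ x
    rw [show (fun x => φ (-x)) = φ from funext he] at this
    rw [this, smul_eq_mul, abs_mul]
    simp

lemma main_pt (N n : ℕ) (hn : n ≤ N) : ∃ K : ℝ, 0 ≤ K ∧ ∀ (ℓ M : ℝ) (φ : ℝ → ℝ), 1 ≤ ℓ → 0 ≤ M →
    ContDiff ℝ (⊤ : ℕ∞) φ → (∀ x : ℝ, φ (-x) = φ x) →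
    (∀ x : ℝ, |x| ≤ ℓ / 2 → φ x = 0) → (∀ x, |iteratedDeriv N φ x| ≤ M) → ∀ x : ℝ,
    |iteratedDeriv n (fun x => φ x * Real.exp (-x ^ 2 / 4)) x| ≤
      K * (M * Real.exp (-ℓ ^ 2 / 16)) *
        (Real.exp (-(1 / 8) * (x - ℓ / 2) ^ 2) + Real.exp (-(1 / 8) * (x + ℓ / 2) ^ 2)) := by
  choose c hc0 hc using gauss_bound
  refine ⟨∑ i ∈ Finset.range (n + 1), (n.choose i : ℝ) * c (n - i) *
    (16 ^ (N - i) * (N - i).factorial), ?_, ?_⟩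
  · refine Finset.sum_nonneg fun i _ => ?_
    have := hc0 (n - i)
    positivity
  intro ℓ M φ hl hM hφ he h0 hN x
  have hg : ContDiff ℝ (⊤ : ℕ∞) (fun x : ℝ => Real.exp (-x ^ 2 / 4)) := by fun_prop
  have hmul := norm_iteratedFDeriv_mul_le hφ hg x (n := n) (by exact_mod_cast le_top)
  simp only [norm_iteratedFDeriv_eq_norm_iteratedDeriv, Real.norm_eq_abs] at hmul
  refine hmul.trans ?_
  rw [Finset.sum_mul, Finset.sum_mul]
  refine Finset.sum_le_sum fun i hi => ?_
  have hi' : i ≤ n := by simp at hi; omega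
  set E := Real.exp (-(1 / 8) * (x - ℓ / 2) ^ 2) + Real.exp (-(1 / 8) * (x + ℓ / 2) ^ 2) with hE
  have hE0 : 0 ≤ E := by positivity
  have key : |iteratedDeriv i φ x| * ((1 + |x|) ^ (n - i) * Real.exp (-x ^ 2 / 4)) ≤
      (16 ^ (N - i) * (N - i).factorial) * (M * Real.exp (-ℓ ^ 2 / 16)) * E := by
    rcases le_total (|x|) (ℓ / 2) with h | h
    · rw [cutoff_deriv_zero ℓ φ hφ (by linarith) h0 i x h]
      simp only [abs_zero, zero_mul]
      positivity
    · have hfl := flat_bound N ℓ M hM φ hφ (by linarith) h0 hN (N - i) i (by omega)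
        (|x| - ℓ / 2) (by linarith)
      rw [add_sub_cancel, ← cutoff_even_abs φ he] at hfl
      have hp := pt_bound (N - i) (n - i) (by omega) ℓ (|x| - ℓ / 2) hl (by linarith)
      rw [add_sub_cancel, sq_abs] at hp
      have hEt : Real.exp (-(1 / 8) * (|x| - ℓ / 2) ^ 2) ≤ E := by
        rcases le_total 0 x with h' | h'
        · rw [abs_of_nonneg h', hE]
          have := Real.exp_pos (-(1 / 8) * (x + ℓ / 2) ^ 2)
          linarith
        · rw [abs_of_nonpos h', hE, show (-x - ℓ / 2) ^ 2 = (x + ℓ / 2) ^ 2 by ring]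
          have := Real.exp_pos (-(1 / 8) * (x - ℓ / 2) ^ 2)
          linarith
      calc _ ≤ (M * (|x| - ℓ / 2) ^ (N - i)) *
            ((1 + |x|) ^ (n - i) * Real.exp (-x ^ 2 / 4)) := by gcongr
        _ = M * ((|x| - ℓ / 2) ^ (N - i) *
            ((1 + |x|) ^ (n - i) * Real.exp (-x ^ 2 / 4))) := by ring
        _ ≤ M * ((16 ^ (N - i) * (N - i).factorial) *
            (Real.exp (-ℓ ^ 2 / 16) * Real.exp (-(1 / 8) * (|x| - ℓ / 2) ^ 2))) := by gcongr
        _ ≤ M * ((16 ^ (N - i) * (N - i).factorial) *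
            (Real.exp (-ℓ ^ 2 / 16) * E)) := by gcongr
        _ = _ := by ring
  have hci := hc0 (n - i)
  calc _ ≤ (n.choose i : ℝ) * |iteratedDeriv i φ x| *
        (c (n - i) * ((1 + |x|) ^ (n - i) * Real.exp (-x ^ 2 / 4))) := by
        gcongr; exact hc _ _
    _ = (n.choose i : ℝ) * c (n - i) * (|iteratedDeriv i φ x| *
        ((1 + |x|) ^ (n - i) * Real.exp (-x ^ 2 / 4))) := by ring
    _ ≤ (n.choose i : ℝ) * c (n - i) * ((16 ^ (N - i) * (N - i).factorial) *
        (M * Real.exp (-ℓ ^ 2 / 16)) * E) := by gcongr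
    _ = _ := by ring

lemma int_bound (N : ℕ) : ∃ K : ℝ, 0 ≤ K ∧ ∀ (ℓ M : ℝ) (φ : ℝ → ℝ), 1 ≤ ℓ → 0 ≤ M →
    ContDiff ℝ (⊤ : ℕ∞) φ → (∀ x : ℝ, φ (-x) = φ x) →
    (∀ x : ℝ, |x| ≤ ℓ / 2 → φ x = 0) → (∀ x, |iteratedDeriv N φ x| ≤ M) →
    ∀ n, n ≤ N → ∀ lam : ℝ, 0 ≤ lam →
    lam ^ n * ‖∫ ξ : ℝ, (φ ξ * Real.exp (-ξ ^ 2 / 4)) • Complex.exp (Complex.I * lam * ξ)‖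
      ≤ K * (M * Real.exp (-ℓ ^ 2 / 16)) := by
  choose K hK0 hK using main_pt N
  let W : ℝ := ∫ x : ℝ, Real.exp (-(1 / 8) * x ^ 2)
  have hW0 : 0 ≤ W := integral_nonneg fun x => (Real.exp_pos _).le
  let KK : ℕ → ℝ := fun n => if h : n ≤ N then K n h else 0
  have hKK0 : ∀ n, 0 ≤ KK n := by
    intro n; dsimp only [KK]; split_ifs with h
    · exact hK0 n h
    · exact le_rfl
  refine ⟨(∑ n ∈ Finset.range (N + 1), KK n) * (2 * W),
    mul_nonneg (Finset.sum_nonneg fun n _ => hKK0 n) (by positivity), ?_⟩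
  intro ℓ M φ hl hM hφ he h0 hN n hn lam hlam
  set g : ℝ → ℝ := fun x => φ x * Real.exp (-x ^ 2 / 4) with hg
  have hgc : ContDiff ℝ (⊤ : ℕ∞) g := by
    have : ContDiff ℝ (⊤ : ℕ∞) (fun x : ℝ => Real.exp (-x ^ 2 / 4)) := by fun_prop
    exact hφ.mul this
  let f : ℝ → ℂ := Complex.ofRealLI ∘ g
  have hfc : ContDiff ℝ (⊤ : ℕ∞) f := Complex.ofRealLI.contDiff.comp hgc
  let E : ℝ → ℝ := fun x =>
    Real.exp (-(1 / 8) * (x - ℓ / 2) ^ 2) + Real.exp (-(1 / 8) * (x + ℓ / 2) ^ 2)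
  have hw : Integrable (fun x : ℝ => Real.exp (-(1 / 8) * x ^ 2)) :=
    integrable_exp_neg_mul_sq (by norm_num)
  have hE1 : Integrable (fun x : ℝ => Real.exp (-(1 / 8) * (x - ℓ / 2) ^ 2)) :=
    hw.comp_sub_right (ℓ / 2)
  have hE2 : Integrable (fun x : ℝ => Real.exp (-(1 / 8) * (x + ℓ / 2) ^ 2)) :=
    hw.comp_add_right (ℓ / 2)
  have hEi : Integrable E := hE1.add hE2
  have hEW : ∫ x, E x = 2 * W := by
    have h1 := integral_sub_right_eq_self (μ := volume)
      (fun x : ℝ => Real.exp (-(1 / 8) * x ^ 2)) (ℓ / 2)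
    have h2 := integral_add_right_eq_self (μ := volume)
      (fun x : ℝ => Real.exp (-(1 / 8) * x ^ 2)) (ℓ / 2)
    have h3 := integral_add hE1 hE2
    refine h3.trans ?_
    rw [h1, h2]
    simp only [W]; ring
  have hpt : ∀ m, m ≤ N → ∀ x, ‖iteratedDeriv m f x‖ ≤
      KK m * (M * Real.exp (-ℓ ^ 2 / 16)) * E x := by
    intro m hm x
    rw [← norm_iteratedFDeriv_eq_norm_iteratedDeriv]
    rw [Complex.ofRealLI.norm_iteratedFDeriv_comp_left (n := ((⊤ : ℕ∞) : WithTop ℕ∞))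
      hgc.contDiffAt (by exact_mod_cast le_top)]
    rw [norm_iteratedFDeriv_eq_norm_iteratedDeriv, Real.norm_eq_abs]
    have := hK m hm ℓ M φ hl hM hφ he h0 hN x
    simpa only [KK, hm, dif_pos] using this
  have hint : ∀ m, m ≤ N → Integrable (iteratedDeriv m f) := by
    intro m hm
    refine (hEi.const_mul (KK m * (M * Real.exp (-ℓ ^ 2 / 16)))).mono' ?_
      (Filter.Eventually.of_forall (hpt m hm))
    exact (hfc.continuous_iteratedDeriv m (by exact_mod_cast le_top)).aestronglyMeasurable
  have hF := Real.fourier_iteratedDeriv (f := f) (N := (N : ℕ∞)) (n := n)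
    (hfc.of_le (by exact_mod_cast le_top)) (fun m hm => hint m (by exact_mod_cast hm))
    (by exact_mod_cast hn)
  have hF1 := congrFun hF (-lam / (2 * π))
  have hI : FourierTransform.fourier f (-lam / (2 * π)) =
      ∫ ξ : ℝ, (φ ξ * Real.exp (-ξ ^ 2 / 4)) • Complex.exp (Complex.I * lam * ξ) := by
    rw [Real.fourier_real_eq_integral_exp_smul]
    refine integral_congr_ae (Filter.Eventually.of_forall fun ξ => ?_)
    have hpi : (π : ℂ) ≠ 0 := by exact_mod_cast Real.pi_ne_zero
    simp only [f, g, Function.comp, Complex.ofRealLI_apply, smul_eq_mul, Complex.real_smul]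
    rw [mul_comm]
    congr 2
    push_cast
    field_simp
  have hnorm := congrArg norm hF1
  simp only [hI] at hnorm
  rw [norm_smul, norm_pow] at hnorm
  have hpi := Real.pi_pos
  have h2 : ‖(2 * (π : ℂ) * I * ((-lam / (2 * π) : ℝ) : ℂ))‖ = lam := by
    rw [norm_mul, Complex.norm_real, norm_mul, Complex.norm_I, norm_mul, Complex.norm_real,
      Real.norm_eq_abs, Real.norm_eq_abs, abs_of_pos hpi, abs_div, abs_neg, abs_of_nonneg hlam,
      abs_of_pos (by positivity)]
    simp
    field_simp
  rw [h2] at hnorm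
  rw [← hnorm, Real.fourier_real_eq_integral_exp_smul]
  refine (norm_integral_le_integral_norm _).trans ?_
  have hle : ∫ x, KK n * (M * Real.exp (-ℓ ^ 2 / 16)) * E x =
      KK n * (M * Real.exp (-ℓ ^ 2 / 16)) * (2 * W) := by
    rw [integral_const_mul, hEW]
  have hKn : KK n ≤ ∑ n ∈ Finset.range (N + 1), KK n :=
    Finset.single_le_sum (fun i _ => hKK0 i) (by simp; omega)
  calc _ ≤ ∫ x, KK n * (M * Real.exp (-ℓ ^ 2 / 16)) * E x := by
        refine integral_mono_of_nonneg (Filter.Eventually.of_forall fun x => norm_nonneg _)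
          (hEi.const_mul _) (Filter.Eventually.of_forall fun x => ?_)
        simp only
        rw [norm_smul, Complex.norm_exp_ofReal_mul_I, one_mul]
        exact hpt n hn x
    _ = KK n * (M * Real.exp (-ℓ ^ 2 / 16)) * (2 * W) := hle
    _ ≤ (∑ n ∈ Finset.range (N + 1), KK n) * (M * Real.exp (-ℓ ^ 2 / 16)) * (2 * W) := by gcongr
    _ = _ := by ring

/-- Proposition `prop:cut off gaussian`: decay of the Fourier transform of
the tail of a Gaussian. -/
theorem statement14 (a : ℕ → ℝ) (ha : ∀ n, 0 < a n) (N : ℕ) :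
    ∃ C : ℝ, 0 < C ∧ ∀ ℓ : ℝ, 1 ≤ ℓ → ∀ φ : ℝ → ℝ, ContDiff ℝ (⊤ : ℕ∞) φ →
      (∀ x : ℝ, φ (-x) = φ x) →
      (∀ x : ℝ, 0 ≤ φ x) → (∀ x : ℝ, φ x ≤ 1) →
      (∀ x : ℝ, ℓ ≤ |x| → φ x = 1) →
      (∀ x : ℝ, |x| ≤ ℓ / 2 → φ x = 0) →
      (∀ n : ℕ, n ≤ N → ∀ x : ℝ, |iteratedDeriv n φ x| ≤ a n / ℓ ^ n) →
      ∀ lam : ℝ, 0 ≤ lam →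
        ‖(1 / (2 * (Real.pi : ℂ))) *
            ∫ ξ : ℝ, (φ ξ * Real.exp (-ξ ^ 2 / 4)) • Complex.exp (Complex.I * lam * ξ)‖
          ≤ C * Real.exp (-ℓ ^ 2 / 16) * (ℓ ^ 2 + lam ^ 2) ^ (-(N : ℝ) / 2) := by
  obtain ⟨K, hK0, hK⟩ := int_bound N
  have haN := ha N
  refine ⟨2 ^ N * (K * a N) + 1, by positivity, ?_⟩
  intro ℓ hl φ hφ he _ _ _ h0 hd lam hlam
  have hl0 : 0 < ℓ := by linarith
  have hb := hK ℓ (a N / ℓ ^ N) φ hl (by positivity) hφ he h0 (hd N le_rfl)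
  have b0 := hb 0 (Nat.zero_le _) lam hlam
  have bN := hb N le_rfl lam hlam
  set J := ‖∫ ξ : ℝ, (φ ξ * Real.exp (-ξ ^ 2 / 4)) • Complex.exp (Complex.I * lam * ξ)‖ with hJ
  have hJ0 : 0 ≤ J := norm_nonneg _
  set e := Real.exp (-ℓ ^ 2 / 16) with he'
  have hepos : 0 < e := Real.exp_pos _
  have hlN : 1 ≤ ℓ ^ N := one_le_pow₀ hl
  have c0 : ℓ ^ N * J ≤ K * (a N * e) := by
    calc ℓ ^ N * J ≤ ℓ ^ N * (K * (a N / ℓ ^ N * e)) := by gcongr; simpa using b0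
      _ = _ := by field_simp
  have cN : lam ^ N * J ≤ K * (a N * e) := by
    refine bN.trans ?_
    gcongr
    exact div_le_self haN.le hlN
  have hS : 0 < ℓ ^ 2 + lam ^ 2 := by positivity
  have hmax : (ℓ ^ 2 + lam ^ 2) ^ ((N : ℝ) / 2) * J ≤ 2 ^ N * (K * (a N * e)) := by
    set m := max ℓ lam with hm
    have hm0 : 0 ≤ m := le_max_of_le_left hl0.le
    have h1 : ℓ ^ 2 + lam ^ 2 ≤ (2 * m) ^ 2 := by
      have := le_max_left ℓ lam
      have := le_max_right ℓ lam
      nlinarith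
    have h2 : (ℓ ^ 2 + lam ^ 2) ^ ((N : ℝ) / 2) ≤ (2 * m) ^ N := by
      calc (ℓ ^ 2 + lam ^ 2) ^ ((N : ℝ) / 2) ≤ ((2 * m) ^ 2) ^ ((N : ℝ) / 2) :=
            Real.rpow_le_rpow hS.le h1 (by positivity)
        _ = (2 * m) ^ N := by
            rw [← Real.rpow_natCast (2 * m) 2, ← Real.rpow_mul (by positivity),
              ← Real.rpow_natCast (2 * m) N]
            congr 1
            push_cast; ring
    have h3 : m ^ N * J ≤ K * (a N * e) := by
      rcases max_choice ℓ lam with h | h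
      · rw [hm, h]; exact c0
      · rw [hm, h]; exact cN
    calc _ ≤ (2 * m) ^ N * J := by gcongr
      _ = 2 ^ N * (m ^ N * J) := by rw [mul_pow]; ring
      _ ≤ _ := by gcongr
  rw [norm_mul, ← hJ, neg_div, Real.rpow_neg hS.le]
  have hSp : 0 < (ℓ ^ 2 + lam ^ 2) ^ ((N : ℝ) / 2) := Real.rpow_pos_of_pos hS _
  rw [← div_eq_mul_inv, le_div_iff₀ hSp]
  have hpi := Real.pi_gt_three
  have hc : ‖(1 / (2 * (Real.pi : ℂ)))‖ ≤ 1 := by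
    rw [norm_div, norm_mul, Complex.norm_real, Real.norm_eq_abs, abs_of_pos Real.pi_pos]
    simp only [norm_one, Complex.norm_ofNat]
    rw [div_le_one (by positivity)]
    linarith
  calc _ ≤ 1 * J * (ℓ ^ 2 + lam ^ 2) ^ ((N : ℝ) / 2) := by gcongr
    _ = (ℓ ^ 2 + lam ^ 2) ^ ((N : ℝ) / 2) * J := by ring
    _ ≤ 2 ^ N * (K * (a N * e)) := hmax
    _ ≤ _ := by nlinarith

end
end

section
/- For all real numbers δ and μ with 0 < δ < μ, one has ∫_{δ²/μ²}^{∞} r^{−1} e^{−r} dr ≤ 2 log( 2μ/δ ). -/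
open MeasureTheory Real

/-- estimate of the incomplete exponential integral. -/
theorem statement16 (δ μ : ℝ) (hδ : 0 < δ) (hμ : δ < μ) :
    (∫ r in Set.Ioi (δ ^ 2 / μ ^ 2), r⁻¹ * Real.exp (-r))
      ≤ 2 * Real.log (2 * μ / δ) := by
  have hμ0 : 0 < μ := hδ.trans hμ
  have hlog : 2 * Real.log (2 * μ / δ) = 2 * Real.log 2 - Real.log (δ ^ 2 / μ ^ 2) := by
    rw [Real.log_div (by positivity) (by positivity), Real.log_mul (by positivity) (by positivity),
      Real.log_div (by positivity) (by positivity), Real.log_pow, Real.log_pow]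
    push_cast
    ring
  rw [hlog]
  have ha0 : 0 < δ ^ 2 / μ ^ 2 := by positivity
  have ha1 : δ ^ 2 / μ ^ 2 ≤ 1 := by
    rw [div_le_one (by positivity)]
    gcongr
  generalize δ ^ 2 / μ ^ 2 = a at *
  have hinv : IntervalIntegrable (fun r : ℝ => r⁻¹) volume a 1 := by
    apply ContinuousOn.intervalIntegrable
    rw [Set.uIcc_of_le ha1]
    exact continuousOn_id.inv₀ (fun x hx => (ha0.trans_le hx.1).ne')
  have hf1 : IntervalIntegrable (fun r : ℝ => r⁻¹ * Real.exp (-r)) volume a 1 :=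
    hinv.mul_continuousOn (by fun_prop)
  have hexp : IntegrableOn (fun r : ℝ => Real.exp (-r)) (Set.Ioi 1) := integrableOn_exp_neg_Ioi 1
  have hb : ∀ r ∈ Set.Ioi (1:ℝ), r⁻¹ * Real.exp (-r) ≤ Real.exp (-r) := by
    intro r hr
    have : r⁻¹ ≤ 1 := inv_le_one_of_one_le₀ (le_of_lt hr)
    exact mul_le_of_le_one_left (Real.exp_pos _).le this
  have hf2 : IntegrableOn (fun r : ℝ => r⁻¹ * Real.exp (-r)) (Set.Ioi 1) := by
    refine Integrable.mono' hexp (by fun_prop) ?_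
    refine (ae_restrict_iff' measurableSet_Ioi).2 (Filter.Eventually.of_forall fun r hr => ?_)
    have h0 : (0:ℝ) < r := lt_trans one_pos hr
    rw [Real.norm_of_nonneg (by positivity)]
    exact hb r hr
  have h1 : ∫ r in a..1, r⁻¹ * Real.exp (-r) ≤ - Real.log a := by
    have : ∫ r in a..1, r⁻¹ = - Real.log a := by
      rw [integral_inv_of_pos ha0 one_pos, one_div, Real.log_inv]
    rw [← this]
    refine intervalIntegral.integral_mono_on ha1 hf1 hinv fun r hr => ?_
    have h0 : 0 < r := ha0.trans_le hr.1
    exact mul_le_of_le_one_right (by positivity) (Real.exp_le_one_iff.2 (by linarith))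
  have h2 : ∫ r in Set.Ioi (1:ℝ), r⁻¹ * Real.exp (-r) ≤ Real.exp (-1) := by
    rw [← integral_exp_neg_Ioi 1]
    exact setIntegral_mono_on hf2 hexp measurableSet_Ioi hb
  rw [← Set.Ioc_union_Ioi_eq_Ioi ha1, setIntegral_union (Set.Ioc_disjoint_Ioi le_rfl)
    measurableSet_Ioi ((intervalIntegrable_iff_integrableOn_Ioc_of_le ha1).1 hf1) hf2,
    ← intervalIntegral.integral_of_le ha1]
  have h3 : Real.exp (-1) ≤ 1 := Real.exp_le_one_iff.2 (by norm_num)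
  have h4 := Real.log_two_gt_d9
  linarith
end
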